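/- For every a₂ ∈ ℂ∖{0}, the assignment k(x_1) = qx_1, k(x_2) = q⁻¹x_2, k(x_3) = x_3, e(x_1) = 0, e(x_2) = a₂x_1, e(x_3) = 0, f(x_1) = a₂⁻¹x_2, f(x_2) = 0, f(x_3) = 0, extended by the module-algebra conditions, defines a module-algebra structure of U_q(sl(2)) on the quantum 3-space A_q(3). -/

import Mathlib

noncomputable section

open scoped BigOperators

/-- The defining relations of the quantum `n`-space `A_q(n)`:
`x_i x_j = q • (x_j x_i)` for `i > j`. -/
inductive QRel (q : ℂ) (n : ℕ) : FreeAlgebra ℂ (Fin n) → FreeAlgebra ℂ (Fin n) → Prop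
  | rel (i j : Fin n) (h : j < i) :
      QRel q n (FreeAlgebra.ι ℂ i * FreeAlgebra.ι ℂ j)
        (q • (FreeAlgebra.ι ℂ j * FreeAlgebra.ι ℂ i))

/-- The quantum `n`-space `A_q(n)`. -/
abbrev QSpace (q : ℂ) (n : ℕ) : Type := RingQuot (QRel q n)

/-- The generator `x_i` of the quantum `n`-space. -/
def Xg (q : ℂ) (n : ℕ) (i : Fin n) : QSpace q n :=
  RingQuot.mkAlgHom ℂ (QRel q n) (FreeAlgebra.ι ℂ i)

/-- The Cartan matrix of `sl(m+1)`: `a_{ii} = 2`, `a_{ij} = -1` if `|i-j| = 1`,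
`a_{ij} = 0` if `|i-j| > 1`. -/
def cartan (m : ℕ) (i j : Fin m) : ℤ :=
  if i = j then 2 else if ((i : ℤ) - (j : ℤ)).natAbs = 1 then -1 else 0

/-- A module-algebra structure of `U_q(sl(m+1))` on a unital `ℂ`-algebra `A`:
`ℂ`-linear maps `k_i` (unital algebra automorphisms with two-sided inverses `(k i).symm`),
`e_i`, `f_i` for `1 ≤ i ≤ m`, satisfying the twisted Leibniz rules and the defining
operator relations of `U_q(sl(m+1))`. -/
structure UqslMA (q : ℂ) (m : ℕ) (A : Type) [Ring A] [Algebra ℂ A] where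
  k : Fin m → (A ≃ₐ[ℂ] A)
  e : Fin m → (A →ₗ[ℂ] A)
  f : Fin m → (A →ₗ[ℂ] A)
  e_mul : ∀ (i : Fin m) (a b : A), e i (a * b) = a * e i b + e i a * k i b
  f_mul : ∀ (i : Fin m) (a b : A), f i (a * b) = (k i).symm a * f i b + f i a * b
  e_one : ∀ i : Fin m, e i 1 = 0
  f_one : ∀ i : Fin m, f i 1 = 0
  k_comm : ∀ (i j : Fin m) (a : A), k i (k j a) = k j (k i a)
  ke : ∀ (i j : Fin m) (a : A), k i (e j ((k i).symm a)) = q ^ cartan m i j • e j a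
  kf : ∀ (i j : Fin m) (a : A), k i (f j ((k i).symm a)) = q ^ (-cartan m i j) • f j a
  ef : ∀ (i j : Fin m) (a : A),
      e i (f j a) - f j (e i a) =
        if i = j then (q - q⁻¹)⁻¹ • (k i a - (k i).symm a) else 0
  ee_comm : ∀ i j : Fin m, cartan m i j = 0 → ∀ a : A, e i (e j a) = e j (e i a)
  ff_comm : ∀ i j : Fin m, cartan m i j = 0 → ∀ a : A, f i (f j a) = f j (f i a)
  serre_e : ∀ i j : Fin m, cartan m i j = -1 → ∀ a : A,
      e i (e i (e j a)) - (q + q⁻¹) • e i (e j (e i a)) + e j (e i (e i a)) = 0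
  serre_f : ∀ i j : Fin m, cartan m i j = -1 → ∀ a : A,
      f i (f i (f j a)) - (q + q⁻¹) • f i (f j (f i a)) + f j (f i (f i a)) = 0

/-- Isomorphism of module-algebra structures: an algebra automorphism `ψ` of `A` with
`ψ ∘ π₁(h) ∘ ψ⁻¹ = π₂(h)` for every generator `h ∈ {k_i^{±1}, e_i, f_i}`. -/
def UqslMA.Iso {q : ℂ} {m : ℕ} {A : Type} [Ring A] [Algebra ℂ A]
    (π₁ π₂ : UqslMA q m A) : Prop :=
  ∃ ψ : A ≃ₐ[ℂ] A,
    (∀ (i : Fin m) (a : A), ψ (π₁.k i (ψ.symm a)) = π₂.k i a) ∧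
    (∀ (i : Fin m) (a : A), ψ ((π₁.k i).symm (ψ.symm a)) = (π₂.k i).symm a) ∧
    (∀ (i : Fin m) (a : A), ψ (π₁.e i (ψ.symm a)) = π₂.e i a) ∧
    (∀ (i : Fin m) (a : A), ψ (π₁.f i (ψ.symm a)) = π₂.f i a)

/-- The generator `x_1` of the quantum 3-space. -/
def Z1 (q : ℂ) : QSpace q 3 := Xg q 3 0
/-- The generator `x_2` of the quantum 3-space. -/
def Z2 (q : ℂ) : QSpace q 3 := Xg q 3 1
/-- The generator `x_3` of the quantum 3-space. -/
def Z3 (q : ℂ) : QSpace q 3 := Xg q 3 2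

/-- A `(σ, τ)`-twisted derivation is determined by its values on a generating family. -/
theorem twisted_derivation_ext {ι A : Type*} [Ring A] [Algebra ℂ A] {x : ι → A}
    (hx : Algebra.adjoin ℂ (Set.range x) = ⊤) {σ τ : A → A} {D E : A →ₗ[ℂ] A}
    (hD : ∀ a b, D (a * b) = σ a * D b + D a * τ b)
    (hE : ∀ a b, E (a * b) = σ a * E b + E a * τ b)
    (h_one : D 1 = E 1) (h_gen : ∀ i, D (x i) = E (x i)) : D = E := by
  ext a
  have ha : a ∈ Algebra.adjoin ℂ (Set.range x) := hx ▸ Algebra.mem_top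
  induction ha using Algebra.adjoin_induction with
  | mem a ha =>
    obtain ⟨i, rfl⟩ := ha
    exact h_gen i
  | algebraMap c => simp [Algebra.algebraMap_eq_smul_one, h_one]
  | mul a b _ _ ha hb => rw [hD, hE, ha, hb]
  | add a b _ _ ha hb => rw [map_add, map_add, ha, hb]

/-- A module-algebra structure of `U_q(sl(2))` can be checked on a generating family, once `e` and `f` satisfy the twisted Leibniz rules. -/
theorem exists_uqslMA {q : ℂ} (hq : q ≠ 0) {ι : Type*} {A : Type} [Ring A] [Algebra ℂ A]
    {x : ι → A} (hx : Algebra.adjoin ℂ (Set.range x) = ⊤) (k : A ≃ₐ[ℂ] A) (e f : A →ₗ[ℂ] A)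
    (e_one : e 1 = 0) (f_one : f 1 = 0)
    (e_mul : ∀ a b, e (a * b) = a * e b + e a * k b)
    (f_mul : ∀ a b, f (a * b) = k.symm a * f b + f a * b)
    (ke : ∀ i, k (e (k.symm (x i))) = q ^ (2 : ℤ) • e (x i))
    (kf : ∀ i, k (f (k.symm (x i))) = q ^ (-2 : ℤ) • f (x i))
    (ef : ∀ i, e (f (x i)) - f (e (x i)) =
      (q - q⁻¹)⁻¹ • (k (x i) - k.symm (x i))) :
    ∃ π : UqslMA q 1 A, π.k 0 = k ∧ π.e 0 = e ∧ π.f 0 = f := by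
  have hcartan : ∀ i j, cartan 1 i j = 2 := fun i j => if_pos (Subsingleton.elim i j)
  have hke : ∀ a, k (e (k.symm a)) = q ^ (2 : ℤ) • e a := by
    refine LinearMap.congr_fun (twisted_derivation_ext hx (σ := id) (τ := k)
      (D := k.toLinearMap ∘ₗ e ∘ₗ k.symm.toLinearMap) (E := q ^ (2 : ℤ) • e) ?_ ?_ ?_ ke)
    · intro a b
      simp [e_mul]
    · intro a b
      simp [e_mul]
    · simp [e_one]
  have hkf : ∀ a, k (f (k.symm a)) = q ^ (-2 : ℤ) • f a := by
    refine LinearMap.congr_fun (twisted_derivation_ext hx (σ := k.symm) (τ := id)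
      (D := k.toLinearMap ∘ₗ f ∘ₗ k.symm.toLinearMap) (E := q ^ (-2 : ℤ) • f) ?_ ?_ ?_ kf)
    · intro a b
      simp [f_mul]
    · intro a b
      simp [f_mul]
    · simp [f_one]
  have hcross : ∀ a b, e (k.symm a) * k (f b) = k.symm (e a) * f (k b) := by
    intro a b
    have h₁ : e (k.symm a) = q ^ (2 : ℤ) • k.symm (e a) := by
      rw [← map_smul, ← hke, AlgEquiv.symm_apply_apply]
    have h₂ : k (f b) = q ^ (-2 : ℤ) • f (k b) := by
      rw [← hkf, AlgEquiv.symm_apply_apply]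
    rw [h₁, h₂, smul_mul_smul_comm, ← zpow_add₀ hq]
    simp
  have hef : ∀ a, e (f a) - f (e a) = (q - q⁻¹)⁻¹ • (k a - k.symm a) := by
    refine LinearMap.congr_fun (twisted_derivation_ext hx (σ := k.symm) (τ := k)
      (D := e ∘ₗ f - f ∘ₗ e)
      (E := (q - q⁻¹)⁻¹ • (k.toLinearMap - k.symm.toLinearMap)) ?_ ?_ ?_ ef)
    · intro a b
      simp only [LinearMap.sub_apply, LinearMap.comp_apply, e_mul, f_mul, map_add, hcross]
      noncomm_ring
    · intro a b
      simp only [LinearMap.smul_apply, LinearMap.sub_apply, AlgEquiv.toLinearMap_apply, map_mul,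
        mul_smul_comm, smul_mul_assoc, ← smul_add]
      noncomm_ring
    · simp [e_one, f_one]
  refine ⟨{
    k := fun _ => k
    e := fun _ => e
    f := fun _ => f
    e_mul := fun _ => e_mul
    f_mul := fun _ => f_mul
    e_one := fun _ => e_one
    f_one := fun _ => f_one
    k_comm := fun _ _ _ => rfl
    ke := fun i j a => by rw [hcartan, hke]
    kf := fun i j a => by rw [hcartan, hkf]
    ef := fun i j a => by rw [if_pos (Subsingleton.elim i j), hef]
    ee_comm := fun _ _ _ _ => rfl
    ff_comm := fun _ _ _ _ => rfl
    serre_e := fun i j h => by simp [hcartan] at h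
    serre_f := fun i j h => by simp [hcartan] at h }, rfl, rfl, rfl⟩

namespace QSpace

variable {q : ℂ} {n : ℕ}

theorem Xg_mul_Xg {i j : Fin n} (h : j < i) :
    Xg q n i * Xg q n j = q • (Xg q n j * Xg q n i) := by
  simpa [Xg] using RingQuot.mkAlgHom_rel ℂ (QRel.rel (q := q) i j h)

/-- The universal property of the quantum `n`-space. -/
def lift {B : Type} [Ring B] [Algebra ℂ B] (y : Fin n → B)
    (hy : ∀ i j, j < i → y i * y j = q • (y j * y i)) : QSpace q n →ₐ[ℂ] B :=
  RingQuot.liftAlgHom ℂ ⟨FreeAlgebra.lift ℂ y, by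
    rintro _ _ ⟨i, j, h⟩
    simpa using hy i j h⟩

@[simp]
theorem lift_Xg {B : Type} [Ring B] [Algebra ℂ B] (y : Fin n → B)
    (hy : ∀ i j, j < i → y i * y j = q • (y j * y i)) (i : Fin n) :
    lift y hy (Xg q n i) = y i := by
  simp [lift, Xg]

theorem induction {P : QSpace q n → Prop} (algebraMap : ∀ c : ℂ, P (algebraMap ℂ _ c))
    (gen : ∀ i, P (Xg q n i)) (mul : ∀ a b, P a → P b → P (a * b))
    (add : ∀ a b, P a → P b → P (a + b)) (a : QSpace q n) : P a := by
  obtain ⟨a, rfl⟩ := RingQuot.mkAlgHom_surjective ℂ (QRel q n) a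
  induction a using FreeAlgebra.induction with
  | grade0 c => simpa using algebraMap c
  | grade1 i => exact gen i
  | mul a b ha hb => simpa using mul _ _ ha hb
  | add a b ha hb => simpa using add _ _ ha hb

theorem adjoin_range_Xg : Algebra.adjoin ℂ (Set.range (Xg q n)) = ⊤ := by
  refine eq_top_iff.2 fun a _ => ?_
  induction a using QSpace.induction with
  | algebraMap c => exact Subalgebra.algebraMap_mem _ c
  | gen i => exact Algebra.subset_adjoin ⟨i, rfl⟩
  | mul a b ha hb => exact mul_mem (ha trivial) (hb trivial)
  | add a b ha hb => exact add_mem (ha trivial) (hb trivial)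

/-- Values on the generators that are compatible with the defining relations extend to a
`(σ, τ)`-twisted derivation. -/
theorem exists_twisted_derivation (σ τ : QSpace q n →ₐ[ℂ] QSpace q n) (d : Fin n → QSpace q n)
    (hd : ∀ i j, j < i → σ (Xg q n i) * d j + d i * τ (Xg q n j) =
      q • (σ (Xg q n j) * d i + d j * τ (Xg q n i))) :
    ∃ D : QSpace q n →ₗ[ℂ] QSpace q n, D 1 = 0 ∧
      (∀ a b, D (a * b) = σ a * D b + D a * τ b) ∧ ∀ i, D (Xg q n i) = d i := by
  let M : QSpace q n →ₐ[ℂ] Matrix (Fin 2) (Fin 2) (QSpace q n) :=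
    lift (fun i => !![σ (Xg q n i), d i; 0, τ (Xg q n i)]) (by
      intro i j h
      have hσ := congrArg σ (Xg_mul_Xg (q := q) h)
      have hτ := congrArg τ (Xg_mul_Xg (q := q) h)
      simp only [map_mul, map_smul] at hσ hτ
      ext r s
      fin_cases r <;> fin_cases s <;> simp [Matrix.mul_apply, Fin.sum_univ_two, hσ, hτ, hd i j h])
  have hM : ∀ a, M a 0 0 = σ a ∧ M a 1 0 = 0 ∧ M a 1 1 = τ a := by
    intro a
    induction a using QSpace.induction with
    | algebraMap c => simp [Matrix.algebraMap_matrix_apply]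
    | gen i => simp [M]
    | mul a b ha hb => simp [Matrix.mul_apply, Fin.sum_univ_two, ha, hb]
    | add a b ha hb => simp [ha, hb]
  refine ⟨(Matrix.entryLinearMap ℂ (QSpace q n) 0 1).comp M.toLinearMap, ?_, ?_, ?_⟩
  · simp
  · intro a b
    simp [Matrix.mul_apply, Fin.sum_univ_two, hM]
  · intro i
    simp [M]

/-- The endomorphism of the quantum `n`-space that rescales each generator. -/
def scaleHom (c : Fin n → ℂ) : QSpace q n →ₐ[ℂ] QSpace q n :=
  lift (fun i => c i • Xg q n i) (by
    intro i j h
    simp only [smul_mul_smul_comm, Xg_mul_Xg h, smul_smul]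
    ring_nf)

@[simp]
theorem scaleHom_Xg (c : Fin n → ℂ) (i : Fin n) :
    scaleHom c (Xg q n i) = c i • Xg q n i :=
  lift_Xg _ _ i

theorem scaleHom_scaleHom {c c' : Fin n → ℂ} (h : ∀ i, c i * c' i = 1) (a : QSpace q n) :
    scaleHom c (scaleHom c' a) = a := by
  induction a using QSpace.induction with
  | algebraMap r => simp
  | gen i => simp [smul_smul, mul_comm (c' i), h]
  | mul a b ha hb => simp [ha, hb]
  | add a b ha hb => simp [ha, hb]

/-- The automorphism of the quantum `n`-space that rescales each generator by a unit. -/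
def scale (c : Fin n → ℂˣ) : QSpace q n ≃ₐ[ℂ] QSpace q n :=
  AlgEquiv.ofAlgHom (scaleHom fun i => (c i : ℂ)) (scaleHom fun i => ((c i)⁻¹ : ℂˣ))
    (AlgHom.ext fun a => scaleHom_scaleHom (by simp) a)
    (AlgHom.ext fun a => scaleHom_scaleHom (by simp) a)

@[simp]
theorem scale_Xg (c : Fin n → ℂˣ) (i : Fin n) :
    scale c (Xg q n i) = (c i : ℂ) • Xg q n i :=
  scaleHom_Xg _ i

@[simp]
theorem scale_symm_Xg (c : Fin n → ℂˣ) (i : Fin n) :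
    (scale c).symm (Xg q n i) = (c i : ℂ)⁻¹ • Xg q n i := by
  rw [← Units.val_inv_eq_inv_val]
  exact scaleHom_Xg _ i

end QSpace

/-- The simplest `U_q(sl(2))`-module-algebra structure on `A_q(3)` of case `(∗₄)`. -/
theorem Uqsl2_on_Aq3_case4_exists (q : ℂ) (hq : q ≠ 0)
    (hq' : ∀ N : ℕ, 0 < N → q ^ N ≠ 1)
    (a₂ : ℂ) (ha₂ : a₂ ≠ 0) :
    ∃ π : UqslMA q 1 (QSpace q 3),
      π.k 0 (Z1 q) = q • Z1 q ∧ π.k 0 (Z2 q) = q⁻¹ • Z2 q ∧ π.k 0 (Z3 q) = Z3 q ∧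
      π.e 0 (Z1 q) = 0 ∧ π.e 0 (Z2 q) = a₂ • Z1 q ∧ π.e 0 (Z3 q) = 0 ∧
      π.f 0 (Z1 q) = a₂⁻¹ • Z2 q ∧ π.f 0 (Z2 q) = 0 ∧ π.f 0 (Z3 q) = 0 := by
  let u : ℂˣ := Units.mk0 q hq
  let k : QSpace q 3 ≃ₐ[ℂ] QSpace q 3 := QSpace.scale ![u, u⁻¹, 1]
  have k0 : k (Xg q 3 0) = q • Xg q 3 0 := by simp [k, u]
  have k1 : k (Xg q 3 1) = q⁻¹ • Xg q 3 1 := by simp [k, u]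
  have k2 : k (Xg q 3 2) = Xg q 3 2 := by simp [k]
  have s0 : k.symm (Xg q 3 0) = q⁻¹ • Xg q 3 0 := by simp [k, u]
  have s1 : k.symm (Xg q 3 1) = q • Xg q 3 1 := by simp [k, u]
  have s2 : k.symm (Xg q 3 2) = Xg q 3 2 := by simp [k]
  have h20 := QSpace.Xg_mul_Xg (q := q) (show (0 : Fin 3) < 2 by decide)
  have h21 := QSpace.Xg_mul_Xg (q := q) (show (1 : Fin 3) < 2 by decide)
  obtain ⟨e, e_one, e_mul, he⟩ := QSpace.exists_twisted_derivation
    (AlgHom.id ℂ (QSpace q 3)) k.toAlgHom ![0, a₂ • Xg q 3 0, 0] (by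
      intro i j h
      fin_cases i <;> fin_cases j <;> simp at h <;>
        simp [k0, k2, h20, smul_smul, mul_comm])
  obtain ⟨f, f_one, f_mul, hf⟩ := QSpace.exists_twisted_derivation
    k.symm.toAlgHom (AlgHom.id ℂ (QSpace q 3)) ![a₂⁻¹ • Xg q 3 1, 0, 0] (by
      intro i j h
      fin_cases i <;> fin_cases j <;> simp at h <;>
        simp [s1, s2, h21, smul_smul, mul_comm])
  have e0 : e (Xg q 3 0) = 0 := he 0
  have e1 : e (Xg q 3 1) = a₂ • Xg q 3 0 := he 1
  have e2 : e (Xg q 3 2) = 0 := he 2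
  have f0 : f (Xg q 3 0) = a₂⁻¹ • Xg q 3 1 := hf 0
  have f1 : f (Xg q 3 1) = 0 := hf 1
  have f2 : f (Xg q 3 2) = 0 := hf 2
  have hqq : q - q⁻¹ ≠ 0 := by
    intro h
    apply hq' 2 two_pos
    rw [sub_eq_zero] at h
    rw [pow_two]
    nth_rewrite 1 [h]
    exact inv_mul_cancel₀ hq
  obtain ⟨π, hk, he', hf'⟩ := exists_uqslMA hq QSpace.adjoin_range_Xg k e f e_one f_one e_mul f_mul
    (by
      intro i
      fin_cases i
      · simp [s0, e0]
      · simp [s1, e1, k0, smul_smul, zpow_ofNat]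
        ring_nf
      · simp [s2, e2])
    (by
      intro i
      fin_cases i
      · simp [s0, f0, k1, smul_smul, zpow_neg, zpow_ofNat]
        ring_nf
      · simp [s1, f1]
      · simp [s2, f2])
    (by
      intro i
      fin_cases i
      · have h := sub_smul q q⁻¹ (Xg q 3 0)
        simp [e0, f0, e1, k0, s0, smul_smul, ← h, ha₂, hqq]
      · have : (q - q⁻¹)⁻¹ * (q⁻¹ - q) = -1 := by
          rw [← neg_sub q, mul_neg, inv_mul_cancel₀ hqq]
        have h := sub_smul q⁻¹ q (Xg q 3 1)
        simp [e1, f1, f0, k1, s1, smul_smul, ← h, ha₂, this]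
      · simp [e2, f2, k2, s2])
  refine ⟨π, ?_⟩
  rw [hk, he', hf']
  exact ⟨k0, k1, k2, e0, e1, e2, f0, f1, f2⟩
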